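/- For every real β ≥ 1, every real h with 0 ≤ h < h_w(β) = log(e^{4β}/(e^{4β}−1)), every real κ > 0, every integer m with m > (2β)^{−1} log(8β(1+κ)) and every integer N ≥ 1, letting H = ⌊(4β)^{−1} log N⌋, one has P_N^{β,h}( {φ ∈ Ω_N : |φ^{−1}(0)| ≤ κ N} ∩ {φ ∈ Ω_N : |{x ∈ Λ_N : 1 ≤ φ(x) ≤ H − m}| ≥ (e^{−2βm}/(1 − e^{−2β})) N²} ) ≤ (1 − e^{−βN})^{−1} exp( −( (1/2) e^{2βm} − 4β(1+κ) ) N ). -/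

import Mathlib

open Real Finset
open scoped Classical

noncomputable section

/-- The box `Λ_N = {1,…,N}²` in `ℤ²`. -/
def Lam (N : ℕ) : Finset (ℤ × ℤ) := Finset.Icc (1:ℤ) (N:ℤ) ×ˢ Finset.Icc (1:ℤ) (N:ℤ)

/-- The four nearest neighbors of a site of `ℤ²`. -/
def nbrs (x : ℤ × ℤ) : Finset (ℤ × ℤ) :=
  {(x.1 + 1, x.2), (x.1 - 1, x.2), (x.1, x.2 + 1), (x.1, x.2 - 1)}

/-- An enlarged box containing all edges touching `Λ_N`. -/
def Box (N : ℕ) : Finset (ℤ × ℤ) := Finset.Icc (0:ℤ) ((N:ℤ)+1) ×ˢ Finset.Icc (0:ℤ) ((N:ℤ)+1)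

/-- The SOS Hamiltonian with zero boundary conditions, for fields vanishing outside `Λ_N`:
each edge `{x,y}` with `x ~ y` touching `Λ_N` is counted twice in the double sum (once from
each endpoint, both endpoints lying in `Box N`), whence the factor `1/2`.  Since the field
vanishes outside `Λ_N`, this equals
`Σ_{{x,y}⊂Λ_N, x~y} |φ(x)−φ(y)| + Σ_{x∈Λ_N, y∉Λ_N, x~y} |φ(x)|`. -/
def Ham (N : ℕ) (φ : ℤ × ℤ → ℤ) : ℝ :=
  (1/2) * ∑ x ∈ Box N, ∑ y ∈ nbrs x, |(φ x : ℝ) - (φ y : ℝ)|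

/-- The level set `φ⁻¹(k)` inside `Λ_N`. -/
def levelSet (N : ℕ) (φ : ℤ × ℤ → ℤ) (k : ℤ) : Finset (ℤ × ℤ) :=
  (Lam N).filter fun x => φ x = k

/-- The configuration space `Ω_N`: nonnegative integer fields vanishing outside `Λ_N`. -/
def Conf (N : ℕ) : Type :=
  {φ : ℤ × ℤ → ℤ // (∀ x, 0 ≤ φ x) ∧ ∀ x ∉ Lam N, φ x = 0}

/-- The Boltzmann weight `exp(−β H_N(φ) + h |φ⁻¹(0)|)`. -/
def weight (N : ℕ) (β h : ℝ) (φ : ℤ × ℤ → ℤ) : ℝ :=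
  Real.exp (-β * Ham N φ + h * ((levelSet N φ 0).card : ℝ))

/-- The partition function `Z_N^{β,h}`. -/
def Z (N : ℕ) (β h : ℝ) : ℝ := ∑' φ : Conf N, weight N β h φ.val

/-- The probability of an event `E ⊆ Ω_N` under `P_N^{β,h}`. -/
def prob (N : ℕ) (β h : ℝ) (E : Set (Conf N)) : ℝ :=
  (∑' φ : Conf N, if φ ∈ E then weight N β h φ.val else 0) / Z N β h

/-- The critical pinning value `h_w(β) = log(e^{4β}/(e^{4β}−1))`. -/
def hw (β : ℝ) : ℝ := Real.log (Real.exp (4*β) / (Real.exp (4*β) - 1))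

/-- Summing over the four neighbors, written out. -/
lemma sum_nbrs (x : ℤ × ℤ) (f : ℤ × ℤ → ℝ) :
    ∑ y ∈ nbrs x, f y =
      f (x.1 + 1, x.2) + f (x.1 - 1, x.2) + f (x.1, x.2 + 1) + f (x.1, x.2 - 1) := by
  unfold nbrs
  rw [sum_insert, sum_insert, sum_insert, sum_singleton]
  · ring
  all_goals
    simp only [mem_insert, mem_singleton, Prod.mk.injEq, not_or]
    omega

lemma sum_comp_le_of_injective {B S : Finset (ℤ × ℤ)} {f : ℤ × ℤ → ℤ × ℤ}
    (hf : Function.Injective f) {g : ℤ × ℤ → ℝ} (hg : ∀ x, 0 ≤ g x) (hS : ∀ x ∉ S, g x = 0) :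
    ∑ x ∈ B, g (f x) ≤ ∑ x ∈ S, g x := by
  rw [← sum_image (f := g) (g := f) (fun x _ y _ h => hf h)]
  calc ∑ x ∈ B.image f, g x ≤ ∑ x ∈ B.image f ∪ S, g x :=
        sum_le_sum_of_subset_of_nonneg subset_union_left fun x _ _ => hg x
    _ = ∑ x ∈ S, g x := (sum_subset subset_union_right fun x _ hx => hS x hx).symm

/-- A nonnegative function supported on `S` contributes at most four times its sum when summed
over all neighbors. -/
lemma sum_sum_nbrs_le {B S : Finset (ℤ × ℤ)} {g : ℤ × ℤ → ℝ} (hg : ∀ x, 0 ≤ g x)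
    (hS : ∀ x ∉ S, g x = 0) :
    ∑ x ∈ B, ∑ y ∈ nbrs x, (g x + g y) ≤ 8 * ∑ x ∈ S, g x := by
  have inj (a b : ℤ) : Function.Injective fun x : ℤ × ℤ => (x.1 + a, x.2 + b) := by
    rintro ⟨x, y⟩ ⟨x', y'⟩ h
    simp only [Prod.mk.injEq] at h ⊢
    omega
  have key (a b : ℤ) : ∑ x ∈ B, g (x.1 + a, x.2 + b) ≤ ∑ x ∈ S, g x :=
    sum_comp_le_of_injective (inj a b) hg hS
  have h0 := key 0 0
  have h1 := key 1 0
  have h2 := key (-1) 0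
  have h3 := key 0 1
  have h4 := key 0 (-1)
  simp only [add_zero, ← sub_eq_add_neg] at h0 h1 h2 h3 h4
  simp only [sum_nbrs, sum_add_distrib]
  linarith

/-- The edge boundary of the box has `4N` edges. -/
lemma sum_boundary_le (N : ℕ) :
    ∑ x ∈ Box N, ∑ y ∈ nbrs x, (if x ∈ Lam N ↔ y ∈ Lam N then (0 : ℝ) else 1) ≤ 8 * N := by
  have key (B S : Finset (ℤ × ℤ)) (hS : S.card ≤ 2 * N) (p : ℤ × ℤ → Prop)
      [DecidablePred p] (hp : ∀ x, ¬ p x → x ∈ S) : ∑ x ∈ B, (if p x then (0 : ℝ) else 1) ≤ 2 * N := by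
    have h : ∑ x ∈ B, (if p x then (0 : ℝ) else 1) = ((B.filter fun x => ¬ p x).card : ℝ) := by
      rw [card_filter]
      push_cast
      exact sum_congr rfl fun x _ => by by_cases h : p x <;> simp [h]
    rw [h]
    have h' : (B.filter fun x => ¬ p x).card ≤ S.card :=
      card_le_card fun x hx => hp x (mem_filter.mp hx).2
    exact_mod_cast h'.trans hS
  have card_pair_mul (a b : ℤ) : (({a, b} : Finset ℤ) ×ˢ Icc (1 : ℤ) N).card ≤ 2 * N := by
    rw [card_product, Int.card_Icc]
    have := card_le_two (a := a) (b := b)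
    simp only [add_sub_cancel_right, Int.toNat_natCast]
    gcongr
  have card_mul_pair (a b : ℤ) : (Icc (1 : ℤ) N ×ˢ ({a, b} : Finset ℤ)).card ≤ 2 * N := by
    rw [card_product, mul_comm, ← card_product]
    exact card_pair_mul a b
  simp only [sum_nbrs, sum_add_distrib]
  have h1 := key (Box N) _ (card_pair_mul 0 N) (fun x => x ∈ Lam N ↔ (x.1 + 1, x.2) ∈ Lam N) (by
    intro x
    simp only [Lam, mem_product, mem_Icc, mem_insert, mem_singleton]
    omega)
  have h2 := key (Box N) _ (card_pair_mul 1 (N + 1))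
    (fun x => x ∈ Lam N ↔ (x.1 - 1, x.2) ∈ Lam N) (by
    intro x
    simp only [Lam, mem_product, mem_Icc, mem_insert, mem_singleton]
    omega)
  have h3 := key (Box N) _ (card_mul_pair 0 N) (fun x => x ∈ Lam N ↔ (x.1, x.2 + 1) ∈ Lam N) (by
    intro x
    simp only [Lam, mem_product, mem_Icc, mem_insert, mem_singleton]
    omega)
  have h4 := key (Box N) _ (card_mul_pair 1 (N + 1))
    (fun x => x ∈ Lam N ↔ (x.1, x.2 - 1) ∈ Lam N) (by
    intro x
    simp only [Lam, mem_product, mem_Icc, mem_insert, mem_singleton]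
    omega)
  linarith

/-- Raise all positive heights by one, keep the zeros, and put height one on `A`. -/
def raise (φ : ℤ × ℤ → ℤ) (A : Finset (ℤ × ℤ)) (x : ℤ × ℤ) : ℤ :=
  if φ x = 0 then 0 else if x ∈ A then 1 else φ x + 1

lemma levelSet_raise_zero {N : ℕ} {φ : ℤ × ℤ → ℤ} (h0 : ∀ x, 0 ≤ φ x) (A : Finset (ℤ × ℤ)) :
    levelSet N (raise φ A) 0 = levelSet N φ 0 := by
  refine filter_congr fun x _ => ?_
  have := h0 x
  unfold raise
  split_ifs <;> omega

lemma Ham_raise_le {N : ℕ} {φ : ℤ × ℤ → ℤ} (hL : ∀ x ∉ Lam N, φ x = 0)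
    {k : ℤ} (hk : 1 ≤ k) {A : Finset (ℤ × ℤ)} (hA : A ⊆ levelSet N φ k) :
    Ham N (raise φ A) ≤
      Ham N φ + 4 * N + 4 * ((levelSet N φ 0).card : ℝ) + 4 * k * (A.card : ℝ) := by
  have hAk : ∀ x ∈ A, φ x = k := fun x hx => (mem_filter.mp (hA hx)).2
  have hk' : (1 : ℝ) ≤ k := by exact_mod_cast hk
  set a : ℤ × ℤ → ℝ := fun x => if x ∈ A then (k : ℝ) else 0 with ha
  set z : ℤ × ℤ → ℝ := fun x => if x ∈ levelSet N φ 0 then (1 : ℝ) else 0 with hz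
  set i : ℤ × ℤ → ℝ := fun x => if φ x = 0 then (0 : ℝ) else 1 with hi
  have ha0 : ∀ x, 0 ≤ a x := fun x => by
    simp only [ha]; split_ifs <;> linarith
  have hz0 : ∀ x, 0 ≤ z x := fun x => by
    simp only [hz]; split_ifs <;> norm_num
  have hraise : ∀ x, (raise φ A x : ℝ) = φ x + i x - a x := by
    intro x
    simp only [raise, ha, hi]
    by_cases h1 : x ∈ A
    · have h2 := hAk x h1
      have h3 : k ≠ 0 := by omega
      simp [h1, h2, h3]
    · by_cases h2 : φ x = 0 <;> simp [h1, h2]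
  have hind : ∀ x y, |i x - i y| ≤
      (z x + z y) + (if x ∈ Lam N ↔ y ∈ Lam N then (0 : ℝ) else 1) := by
    intro x y
    have hx := hL x
    have hy := hL y
    simp only [hi, hz, levelSet, mem_filter]
    by_cases h1 : x ∈ Lam N <;> by_cases h2 : y ∈ Lam N <;> by_cases h3 : φ x = 0 <;>
      by_cases h4 : φ y = 0 <;> simp_all
  have hpt : ∀ x y, |(raise φ A x : ℝ) - raise φ A y| ≤ |(φ x : ℝ) - φ y| + (a x + a y) +
      (z x + z y) + (if x ∈ Lam N ↔ y ∈ Lam N then (0 : ℝ) else 1) := by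
    intro x y
    rw [hraise, hraise]
    have h1 := hind x y
    have h2 : |a x - a y| ≤ a x + a y := by
      rw [abs_le]; constructor <;> linarith [ha0 x, ha0 y]
    have h3 : (φ x + i x - a x) - (φ y + i y - a y) =
        ((φ x : ℝ) - φ y) + (i x - i y) - (a x - a y) := by ring
    rw [h3]
    have h4 := abs_sub (((φ x : ℝ) - φ y) + (i x - i y)) (a x - a y)
    have h5 := abs_add_le ((φ x : ℝ) - φ y) (i x - i y)
    linarith
  have hsum := sum_le_sum fun x (_ : x ∈ Box N) => sum_le_sum fun y (_ : y ∈ nbrs x) => hpt x y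
  have h1 := sum_sum_nbrs_le (B := Box N) (S := A) ha0 fun x hx => by simp [ha, hx]
  have h2 := sum_sum_nbrs_le (B := Box N) (S := levelSet N φ 0) hz0 fun x hx => by simp [hz, hx]
  have h3 := sum_boundary_le N
  have h4 : ∑ x ∈ A, a x = A.card * k := by
    rw [sum_congr rfl fun x hx => show a x = k by simp [ha, hx]]
    simp
  have h5 : ∑ x ∈ levelSet N φ 0, z x = (levelSet N φ 0).card := by
    rw [sum_congr rfl fun x hx => show z x = 1 by simp [hz, hx]]
    simp
  rw [h4] at h1
  rw [h5] at h2
  simp only [sum_add_distrib] at hsum h1 h2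
  unfold Ham
  linarith

lemma raise_apply_injective {φ φ' : ℤ × ℤ → ℤ} {k : ℤ} (hk : 1 ≤ k) {A A' : Finset (ℤ × ℤ)}
    {x : ℤ × ℤ} (hφ : 0 ≤ φ x) (hφ' : 0 ≤ φ' x) (hA : x ∈ A → φ x = k) (hA' : x ∈ A' → φ' x = k)
    (h : raise φ A x = raise φ' A' x) : φ x = φ' x ∧ (x ∈ A ↔ x ∈ A') := by
  unfold raise at h
  by_cases h1 : x ∈ A <;> by_cases h2 : x ∈ A' <;>
    simp only [h1, h2, if_true, if_false, iff_false, not_true, forall_const, and_true,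
      and_false] at h hA hA' ⊢ <;>
    split_ifs at h <;> omega

/-- `raise` as a map on configurations. -/
def Conf.raise {N : ℕ} (φ : Conf N) (A : Finset (ℤ × ℤ)) : Conf N :=
  ⟨_root_.raise φ.val A, fun x => by
      have := φ.2.1 x
      unfold _root_.raise
      split_ifs <;> omega,
    fun x hx => by simp [_root_.raise, φ.2.2 x hx]⟩

/-- The configuration and the set can be recovered from the raised configuration. -/
lemma Conf.raise_injective {N : ℕ} {k : ℤ} (hk : 1 ≤ k) {φ φ' : Conf N} {A A' : Finset (ℤ × ℤ)}
    (hA : A ⊆ levelSet N φ.val k) (hA' : A' ⊆ levelSet N φ'.val k)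
    (h : φ.raise A = φ'.raise A') : φ = φ' ∧ A = A' := by
  have hx (x : ℤ × ℤ) : φ.val x = φ'.val x ∧ (x ∈ A ↔ x ∈ A') :=
    raise_apply_injective hk (φ.2.1 x) (φ'.2.1 x) (fun hx => (mem_filter.mp (hA hx)).2)
      (fun hx => (mem_filter.mp (hA' hx)).2) (congrFun (congrArg Subtype.val h) x)
  exact ⟨Subtype.ext (funext fun x => (hx x).1), Finset.ext fun x => (hx x).2⟩

lemma weight_pos (N : ℕ) (β h : ℝ) (φ : ℤ × ℤ → ℤ) : 0 < weight N β h φ := exp_pos _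

lemma weight_le_weight_raise {N : ℕ} {β κ : ℝ} (h : ℝ) (hβ : 0 ≤ β) {φ : Conf N}
    (hφ : ((levelSet N φ.val 0).card : ℝ) ≤ κ * N) {k : ℤ} (hk : 1 ≤ k) {A : Finset (ℤ × ℤ)}
    (hA : A ⊆ levelSet N φ.val k) :
    weight N β h φ.val * exp (-4 * β * (1 + κ) * N) * exp (-4 * β * k) ^ A.card ≤
      weight N β h (φ.raise A).val := by
  have hH := Ham_raise_le φ.2.2 hk hA
  change _ ≤ weight N β h (raise φ.val A)
  unfold weight
  rw [levelSet_raise_zero φ.2.1, ← exp_nat_mul, ← exp_add, ← exp_add, exp_le_exp]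
  have := mul_le_mul_of_nonneg_left hH hβ
  have := mul_le_mul_of_nonneg_left hφ hβ
  linarith

lemma exp_half_le_one_add {t : ℝ} (h0 : 0 ≤ t) (h1 : t ≤ 1) : exp (t / 2) ≤ 1 + t := by
  have h := exp_bound_div_one_sub_of_interval (x := t / 2) (by linarith) (by linarith)
  refine h.trans ?_
  rw [div_le_iff₀ (by linarith)]
  nlinarith

lemma sum_biUnion_le_sum {ι α : Type*} [DecidableEq α] (T : Finset ι) (S : ι → Finset α)
    {f : α → ℝ} (hf : ∀ a, 0 ≤ f a) :
    ∑ a ∈ T.biUnion S, f a ≤ ∑ i ∈ T, ∑ a ∈ S i, f a := by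
  induction T using Finset.induction_on with
  | empty => simp
  | insert i T hi ih =>
    rw [biUnion_insert, sum_insert hi]
    have h := sum_union_inter (s₁ := S i) (s₂ := T.biUnion S) (f := f)
    have h' : 0 ≤ ∑ a ∈ S i ∩ T.biUnion S, f a := sum_nonneg fun a _ => hf a
    linarith

lemma prob_le_of_sum_le {N : ℕ} {β h C : ℝ} {E : Set (Conf N)} (hC : 0 ≤ C)
    (hE : (Summable fun φ : Conf N => weight N β h φ.val) → ∀ F : Finset (Conf N),
      (∀ φ ∈ F, φ ∈ E) → ∑ φ ∈ F, weight N β h φ.val ≤ C * Z N β h) :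
    prob N β h E ≤ C := by
  unfold prob
  by_cases hs : Summable fun φ : Conf N => weight N β h φ.val
  swap
  · rw [Z, tsum_eq_zero_of_not_summable hs, div_zero]
    exact hC
  refine div_le_of_le_mul₀ (tsum_nonneg fun φ => (weight_pos _ _ _ _).le) hC ?_
  refine Real.tsum_le_of_sum_le
    (fun φ => by split_ifs <;> simp [(weight_pos N β h φ.val).le]) fun F => ?_
  refine (sum_filter (· ∈ E) fun φ : Conf N => weight N β h φ.val).symm.trans_le ?_
  exact hE hs _ fun φ hφ => (mem_filter.mp hφ).2

/-- Configurations with few zeros and many sites at height `k` have small total weight. -/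
lemma sum_weight_le {N : ℕ} {β h κ : ℝ} (hβ : 0 ≤ β)
    (hs : Summable fun φ : Conf N => weight N β h φ.val) {k : ℤ} (hk : 1 ≤ k) {n : ℝ}
    (F : Finset (Conf N)) (hF : ∀ φ ∈ F, ((levelSet N φ.val 0).card : ℝ) ≤ κ * N)
    (hn : ∀ φ ∈ F, n ≤ (levelSet N φ.val k).card) :
    ∑ φ ∈ F, weight N β h φ.val ≤
      exp (4 * β * (1 + κ) * N - exp (-4 * β * k) * n / 2) * Z N β h := by
  have hk' : (1 : ℝ) ≤ k := by exact_mod_cast hk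
  set t := exp (-4 * β * k) with ht
  have ht0 : 0 < t := exp_pos _
  have ht1 : t ≤ 1 := exp_le_one_iff.mpr (by nlinarith)
  have hsig : ∑ p ∈ F.sigma fun φ => (levelSet N φ.val k).powerset,
      weight N β h (p.1.raise p.2).val ≤ Z N β h := by
    rw [← sum_image (f := fun φ : Conf N => weight N β h φ.val)
      (g := fun p : (_ : Conf N) × Finset (ℤ × ℤ) => p.1.raise p.2)]
    · exact hs.sum_le_tsum _ fun φ _ => (weight_pos _ _ _ _).le
    · rintro ⟨φ, A⟩ hp ⟨φ', A'⟩ hp' heq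
      simp only [coe_sigma, Set.mem_sigma_iff, mem_coe, mem_powerset] at hp hp'
      obtain ⟨rfl, rfl⟩ := Conf.raise_injective hk hp.2 hp'.2 heq
      rfl
  rw [sum_sigma] at hsig
  rw [← mul_le_mul_iff_right₀ (exp_pos (-(4 * β * (1 + κ) * N - t * n / 2))), ← mul_assoc,
    ← exp_add, neg_add_cancel, exp_zero, one_mul, mul_sum]
  refine le_trans (sum_le_sum fun φ hφ => ?_) hsig
  calc exp (-(4 * β * (1 + κ) * N - t * n / 2)) * weight N β h φ.val
      = weight N β h φ.val * exp (-4 * β * (1 + κ) * N) * exp (n * (t / 2)) := by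
        rw [mul_assoc (weight N β h φ.val), ← exp_add, mul_comm]
        congr 2
        ring
    _ ≤ weight N β h φ.val * exp (-4 * β * (1 + κ) * N) *
          exp ((levelSet N φ.val k).card * (t / 2)) := by
        have := weight_pos N β h φ.val
        have := hn φ hφ
        gcongr
    _ ≤ weight N β h φ.val * exp (-4 * β * (1 + κ) * N) *
          (1 + t) ^ (levelSet N φ.val k).card := by
        have := weight_pos N β h φ.val
        rw [exp_nat_mul]
        gcongr
        exact exp_half_le_one_add ht0.le ht1
    _ = ∑ A ∈ (levelSet N φ.val k).powerset,
          weight N β h φ.val * exp (-4 * β * (1 + κ) * N) * t ^ A.card := by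
        rw [← mul_sum, add_comm 1 t, ← sum_pow_mul_eq_add_pow]
        simp only [one_pow, mul_one]
    _ ≤ _ := sum_le_sum fun A hA =>
        weight_le_weight_raise h hβ (hF φ hφ) hk (mem_powerset.mp hA)

/-- If many sites have heights between `1` and `K`, then some height `K - j` is taken by many
sites, with a geometrically decreasing threshold in `j`. -/
lemma exists_level_card_ge {N : ℕ} (hN : 1 ≤ N) (φ : ℤ × ℤ → ℤ) {c r : ℝ} (hc : 0 < c)
    (hr0 : 0 < r) (hr1 : r < 1) (K : ℤ)
    (hφ : c / (1 - r) * (N : ℝ) ^ 2 ≤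
      (((Lam N).filter fun x => 1 ≤ φ x ∧ φ x ≤ K).card : ℝ)) :
    ∃ j ∈ range K.toNat, c * r ^ j * (N : ℝ) ^ 2 ≤ ((levelSet N φ (K - j)).card : ℝ) := by
  by_contra! hcon
  have hN' : (0 : ℝ) < N := by exact_mod_cast hN
  have hsub : (Lam N).filter (fun x => 1 ≤ φ x ∧ φ x ≤ K) ⊆
      (range K.toNat).biUnion fun j => levelSet N φ (K - j) := by
    intro x hx
    simp only [mem_filter, mem_biUnion, mem_range, levelSet] at hx ⊢
    exact ⟨(K - φ x).toNat, by omega, hx.1, by omega⟩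
  have hcard : (((Lam N).filter fun x => 1 ≤ φ x ∧ φ x ≤ K).card : ℝ) ≤
      ∑ j ∈ range K.toNat, ((levelSet N φ (K - j)).card : ℝ) := by
    exact_mod_cast (card_le_card hsub).trans card_biUnion_le
  have hle : ∑ j ∈ range K.toNat, ((levelSet N φ (K - j)).card : ℝ) ≤
      ∑ j ∈ range K.toNat, c * r ^ j * (N : ℝ) ^ 2 := sum_le_sum fun j hj => (hcon j hj).le
  have hgeom : ∑ j ∈ range K.toNat, c * r ^ j * (N : ℝ) ^ 2 < c / (1 - r) * (N : ℝ) ^ 2 := by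
    have h1r : 0 < 1 - r := by linarith
    rw [← sum_mul, ← mul_sum, geom_sum_eq hr1.ne]
    gcongr
    rw [div_eq_mul_inv c]
    gcongr
    rw [← neg_div_neg_eq, neg_sub, neg_sub, inv_eq_one_div]
    gcongr
    linarith [pow_pos hr0 K.toNat]
  linarith

/-- The bound for a single level, in the form needed for a geometric sum. -/
lemma exp_level_le {β κ : ℝ} {m H : ℤ} {N : ℕ} (hβ : 1 ≤ β) (hm : 1 ≤ exp (2 * β * m))
    (hN : 1 ≤ N) (hH : 4 * β * H ≤ log N) (j : ℕ) :
    exp (4 * β * (1 + κ) * N - exp (-4 * β * ((H - m - j : ℤ) : ℝ)) *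
        (exp (-2 * β * m) * exp (-2 * β) ^ j * (N : ℝ) ^ 2) / 2) ≤
      exp (-((1 / 2) * exp (2 * β * m) - 4 * β * (1 + κ)) * N) * exp (-β * N) ^ j := by
  have hN' : (0 : ℝ) < N := by exact_mod_cast hN
  rw [← exp_nat_mul (-β * N), ← exp_add, exp_le_exp]
  have h1 : exp (2 * β * m) * (1 + 2 * β * j) * N ≤ exp (-4 * β * ((H - m - j : ℤ) : ℝ)) *
      (exp (-2 * β * m) * exp (-2 * β) ^ j * (N : ℝ) ^ 2) := by
    have hNl : (1 : ℝ) ≤ exp (-(4 * β * H)) * N := by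
      calc (1 : ℝ) ≤ exp (-(4 * β * H) + log N) := one_le_exp (by linarith)
        _ = _ := by rw [exp_add, exp_log hN']
    have heq : exp (-4 * β * ((H - m - j : ℤ) : ℝ)) *
        (exp (-2 * β * m) * exp (-2 * β) ^ j * (N : ℝ) ^ 2) =
        exp (2 * β * m) * exp (2 * β * j) * N * (exp (-(4 * β * H)) * N) := by
      have : exp (-4 * β * ((H - m - j : ℤ) : ℝ)) * (exp (-2 * β * m) * exp (-2 * β) ^ j) =
          exp (2 * β * m) * exp (2 * β * j) * exp (-(4 * β * H)) := by
        rw [← exp_nat_mul, ← exp_add, ← exp_add, ← exp_add, ← exp_add]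
        push_cast
        ring_nf
      linear_combination (N : ℝ) ^ 2 * this
    rw [heq]
    calc exp (2 * β * m) * (1 + 2 * β * j) * N ≤ exp (2 * β * m) * exp (2 * β * j) * N := by
          gcongr
          linarith [add_one_le_exp (2 * β * j)]
      _ ≤ _ := le_mul_of_one_le_right (by positivity) hNl
  have h2 : (j : ℝ) * β * N ≤ exp (2 * β * m) * (j * β * N) :=
    le_mul_of_one_le_left (by positivity) hm
  linarith

/-- Lemma 3.2: downward fluctuations below `H − m` are unlikely on the event that there
are at most `κ N` zeros, provided `m > (2β)⁻¹ log(8β(1+κ))`. -/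
theorem downward_fluctuations_few_zeros (β h κ : ℝ) (m : ℤ) (N : ℕ)
    (hβ : 1 ≤ β) (hh0 : 0 ≤ h) (hhw : h < hw β) (hκ : 0 < κ)
    (hm : Real.log (8*β*(1+κ)) / (2*β) < (m : ℝ)) (hN : 1 ≤ N) :
    prob N β h
        ({φ : Conf N | ((levelSet N φ.val 0).card : ℝ) ≤ κ * (N:ℝ)} ∩
          {φ : Conf N |
            Real.exp (-2*β*(m:ℝ)) / (1 - Real.exp (-2*β)) * (N:ℝ)^2 ≤
              (((Lam N).filter fun x =>
                  1 ≤ φ.val x ∧ φ.val x ≤ ⌊Real.log (N:ℝ) / (4*β)⌋ - m).card : ℝ)}) ≤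
      (1 - Real.exp (-β*(N:ℝ)))⁻¹ *
        Real.exp (-((1/2) * Real.exp (2*β*(m:ℝ)) - 4*β*(1+κ)) * (N:ℝ)) := by
  have hN' : (1 : ℝ) ≤ N := by exact_mod_cast hN
  have hq : Real.exp (-β * N) < 1 := Real.exp_lt_one_iff.mpr (by nlinarith)
  set R := Real.exp (-((1/2) * Real.exp (2*β*(m:ℝ)) - 4*β*(1+κ)) * (N:ℝ)) with hR
  have hR0 : 0 < R := exp_pos _
  have hbound : 0 ≤ (1 - Real.exp (-β*(N:ℝ)))⁻¹ * R :=
    mul_nonneg (inv_nonneg.mpr (by linarith)) hR0.le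
  set E := {φ : Conf N | ((levelSet N φ.val 0).card : ℝ) ≤ κ * (N:ℝ)} ∩
          {φ : Conf N |
            Real.exp (-2*β*(m:ℝ)) / (1 - Real.exp (-2*β)) * (N:ℝ)^2 ≤
              (((Lam N).filter fun x =>
                  1 ≤ φ.val x ∧ φ.val x ≤ ⌊Real.log (N:ℝ) / (4*β)⌋ - m).card : ℝ)} with hE
  set H := ⌊Real.log (N:ℝ) / (4*β)⌋ with hH
  have hH' : 4 * β * H ≤ Real.log N := by
    have := Int.floor_le (Real.log (N:ℝ) / (4*β))
    rw [le_div_iff₀ (by linarith)] at this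
    linarith
  have hm' : 1 ≤ Real.exp (2 * β * m) := by
    rw [div_lt_iff₀ (by linarith)] at hm
    have : 0 ≤ Real.log (8*β*(1+κ)) := log_nonneg (by nlinarith)
    exact one_le_exp (by linarith)
  have hZ : 0 ≤ Z N β h := tsum_nonneg fun φ => (weight_pos _ _ _ _).le
  refine prob_le_of_sum_le hbound fun hs F hF => ?_
  set S : ℕ → Finset (Conf N) := fun j => F.filter fun φ =>
    Real.exp (-2 * β * m) * Real.exp (-2 * β) ^ j * (N : ℝ) ^ 2 ≤
      ((levelSet N φ.val (H - m - j)).card : ℝ) with hS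
  have hcover : F ⊆ (range (H - m).toNat).biUnion S := by
    intro φ hφ
    obtain ⟨j, hj, hle⟩ := exists_level_card_ge hN φ.val (exp_pos _) (exp_pos _)
      (Real.exp_lt_one_iff.mpr (by linarith)) (H - m) (hF φ hφ).2
    exact mem_biUnion.mpr ⟨j, hj, mem_filter.mpr ⟨hφ, hle⟩⟩
  calc ∑ φ ∈ F, weight N β h φ.val
      ≤ ∑ φ ∈ (range (H - m).toNat).biUnion S, weight N β h φ.val :=
        sum_le_sum_of_subset_of_nonneg hcover fun φ _ _ => (weight_pos _ _ _ _).le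
    _ ≤ ∑ j ∈ range (H - m).toNat, ∑ φ ∈ S j, weight N β h φ.val :=
        sum_biUnion_le_sum _ _ fun φ => (weight_pos _ _ _ _).le
    _ ≤ ∑ j ∈ range (H - m).toNat, R * Real.exp (-β * N) ^ j * Z N β h := by
        refine sum_le_sum fun j hj => ?_
        rw [mem_range] at hj
        refine (sum_weight_le (κ := κ) (by linarith) hs (k := H - m - j) (by omega) (S j)
          (fun φ hφ => (hF φ (mem_filter.mp hφ).1).1)
          fun φ hφ => (mem_filter.mp hφ).2).trans ?_
        exact mul_le_mul_of_nonneg_right (exp_level_le hβ hm' hN hH' j) hZ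
    _ = (∑ j ∈ range (H - m).toNat, Real.exp (-β * N) ^ j) * R * Z N β h := by
        rw [← sum_mul, ← mul_sum, mul_comm R]
    _ ≤ (1 - Real.exp (-β*(N:ℝ)))⁻¹ * R * Z N β h := by
        gcongr
        rw [← tsum_geometric_of_lt_one (exp_pos _).le hq]
        exact (summable_geometric_of_lt_one (exp_pos _).le hq).sum_le_tsum _
          fun j _ => by positivity
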